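/- Assume the project is PCL-indexable, i.e., conditions (PCLI1), (PCLI2) and (PCLI3) hold. Then for every initial distribution p on ℝ with ∫ w dp < ∞ and all extended thresholds −∞ ≤ z₁ < z₂ ≤ ∞: F(p,z₂) − F(p,z₁) = ∫_{(z₁,z₂]} m*(z) G(p,dz), where (z₁,z₂] denotes the real interval {z ∈ ℝ : z₁ < z ≤ z₂} (so that (−∞,∞] = ℝ) and F(p,±∞) are the always-passive and always-active policy values. -/

import Mathlib

open MeasureTheory ProbabilityTheory Filter Topology Set

noncomputable section

/-- A restless bandit project: the model data (discount factor `β`, passive/active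
Markov transition kernels `κ false`/`κ true`, reward `r` and resource consumption `c`),
Assumption 1 (the weighted sup-norm conditions for weight `w` and constants `M`, `γ`),
together with the threshold-policy performance metrics `F`, `G` (for `z`-policies,
active iff `x > z`), `Fm`, `Gm` (for `z⁻`-policies, active iff `x ≥ z`), and the
optimal value function `V lam` of the `lam`-price problem, each of which is the
(unique) `w`-bounded measurable solution of its fixed-point equation. -/
structure Bandit where
  β : ℝ
  κ : Bool → Kernel ℝ ℝ
  r : ℝ → Bool → ℝ
  c : ℝ → Bool → ℝ
  w : ℝ → ℝ
  M : ℝ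
  γ : ℝ
  F : ℝ → EReal → ℝ
  G : ℝ → EReal → ℝ
  Fm : ℝ → EReal → ℝ
  Gm : ℝ → EReal → ℝ
  V : ℝ → ℝ → ℝ
  hβ0 : 0 ≤ β
  hβ1 : β < 1
  hκ : ∀ a, IsMarkovKernel (κ a)
  hr_cont : ∀ a, Continuous fun x => r x a
  hc_cont : ∀ a, Continuous fun x => c x a
  hc0 : ∀ x, 0 ≤ c x false
  hc01 : ∀ x, c x false < c x true
  hw_meas : Measurable w
  hw_one : ∀ x, 1 ≤ w x
  hM : 0 < M
  hβγ : β ≤ γ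
  hγ1 : γ < 1
  hr_bd : ∀ x a, |r x a| ≤ M * w x
  hc_bd : ∀ x a, c x a ≤ M * w x
  hw_int : ∀ a x, Integrable w (κ a x)
  hw_drift : ∀ a x, β * ∫ y, w y ∂(κ a x) ≤ γ * w x
  hF_meas : ∀ z, Measurable fun x => F x z
  hG_meas : ∀ z, Measurable fun x => G x z
  hFm_meas : ∀ z, Measurable fun x => Fm x z
  hGm_meas : ∀ z, Measurable fun x => Gm x z
  hV_meas : ∀ lam, Measurable (V lam)
  hF_bdd : ∀ z, ∃ C, ∀ x, |F x z| ≤ C * w x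
  hG_bdd : ∀ z, ∃ C, ∀ x, |G x z| ≤ C * w x
  hFm_bdd : ∀ z, ∃ C, ∀ x, |Fm x z| ≤ C * w x
  hGm_bdd : ∀ z, ∃ C, ∀ x, |Gm x z| ≤ C * w x
  hV_bdd : ∀ lam, ∃ C, ∀ x, |V lam x| ≤ C * w x
  hF_eq : ∀ x z, F x z =
    r x (decide (z < (x : EReal))) +
      β * ∫ y, F y z ∂(κ (decide (z < (x : EReal))) x)
  hG_eq : ∀ x z, G x z =
    c x (decide (z < (x : EReal))) +
      β * ∫ y, G y z ∂(κ (decide (z < (x : EReal))) x)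
  hFm_eq : ∀ x z, Fm x z =
    r x (decide (z ≤ (x : EReal))) +
      β * ∫ y, Fm y z ∂(κ (decide (z ≤ (x : EReal))) x)
  hGm_eq : ∀ x z, Gm x z =
    c x (decide (z ≤ (x : EReal))) +
      β * ∫ y, Gm y z ∂(κ (decide (z ≤ (x : EReal))) x)
  hV_eq : ∀ lam x, V lam x =
    max (r x false - lam * c x false + β * ∫ y, V lam y ∂(κ false x))
        (r x true - lam * c x true + β * ∫ y, V lam y ∂(κ true x))

/-- `ν` is the Lebesgue–Stieltjes measure of the (bounded nonincreasing
right-continuous) function `h`: `ν(z₁,z₂] = h z₁ - h z₂`. -/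
def IsLSMeasureOfAnti (h : ℝ → ℝ) (ν : Measure ℝ) : Prop :=
  ∀ z₁ z₂ : ℝ, z₁ ≤ z₂ → ν (Set.Ioc z₁ z₂) = ENNReal.ofReal (h z₁ - h z₂)

/-- `ν` is the Lebesgue–Stieltjes measure of the (bounded nondecreasing
right-continuous) function `h`: `ν(z₁,z₂] = h z₂ - h z₁`. -/
def IsLSMeasureOfMono (h : ℝ → ℝ) (ν : Measure ℝ) : Prop :=
  ∀ z₁ z₂ : ℝ, z₁ ≤ z₂ → ν (Set.Ioc z₁ z₂) = ENNReal.ofReal (h z₂ - h z₁)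

/-- The real interval `(z₁, z₂] ⊆ ℝ` with extended-real endpoints. -/
def iocR (z₁ z₂ : EReal) : Set ℝ := {y : ℝ | z₁ < (y : EReal) ∧ (y : EReal) ≤ z₂}

/-- `t`-step distribution of the Markov chain with kernel `κ` and initial law `p`. -/
def kerIter (κ : Kernel ℝ ℝ) : ℕ → Measure ℝ → Measure ℝ
  | 0, p => p
  | (t + 1), p => (kerIter κ t p).bind fun x => κ x

namespace Bandit

variable (P : Bandit)

/-- Marginal reward metric `f(x,z)` of the `z`-policy. -/
def f (x : ℝ) (z : EReal) : ℝ :=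
  (P.r x true - P.r x false) +
    P.β * ((∫ y, P.F y z ∂(P.κ true x)) - ∫ y, P.F y z ∂(P.κ false x))

/-- Marginal resource metric `g(x,z)` of the `z`-policy. -/
def g (x : ℝ) (z : EReal) : ℝ :=
  (P.c x true - P.c x false) +
    P.β * ((∫ y, P.G y z ∂(P.κ true x)) - ∫ y, P.G y z ∂(P.κ false x))

/-- Marginal reward metric `f(x,z⁻)` of the `z⁻`-policy. -/
def fm (x : ℝ) (z : EReal) : ℝ :=
  (P.r x true - P.r x false) +
    P.β * ((∫ y, P.Fm y z ∂(P.κ true x)) - ∫ y, P.Fm y z ∂(P.κ false x))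

/-- Marginal resource metric `g(x,z⁻)` of the `z⁻`-policy. -/
def gm (x : ℝ) (z : EReal) : ℝ :=
  (P.c x true - P.c x false) +
    P.β * ((∫ y, P.Gm y z ∂(P.κ true x)) - ∫ y, P.Gm y z ∂(P.κ false x))

/-- Marginal productivity metric `m(x,z) = f(x,z)/g(x,z)`. -/
def m (x : ℝ) (z : EReal) : ℝ := P.f x z / P.g x z

/-- Marginal productivity metric `m(x,z⁻) = f(x,z⁻)/g(x,z⁻)`. -/
def mm (x : ℝ) (z : EReal) : ℝ := P.fm x z / P.gm x z

/-- The marginal productivity (MP) index `m*(x) = m(x,x)`. -/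
def mStar (x : ℝ) : ℝ := P.m x (x : EReal)

/-- The active action is `P_lam`-optimal at `x`. -/
def ActOpt (lam x : ℝ) : Prop :=
  P.r x false - lam * P.c x false + P.β * ∫ y, P.V lam y ∂(P.κ false x) ≤
    P.r x true - lam * P.c x true + P.β * ∫ y, P.V lam y ∂(P.κ true x)

/-- The passive action is `P_lam`-optimal at `x`. -/
def PassOpt (lam x : ℝ) : Prop :=
  P.r x true - lam * P.c x true + P.β * ∫ y, P.V lam y ∂(P.κ true x) ≤
    P.r x false - lam * P.c x false + P.β * ∫ y, P.V lam y ∂(P.κ false x)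

/-- The project is indexable with index `ν`. -/
def Indexable (ν : ℝ → ℝ) : Prop :=
  ∀ lam x, (P.ActOpt lam x ↔ lam ≤ ν x) ∧ (P.PassOpt lam x ↔ ν x ≤ lam)

/-- The `z`-policy is `P_lam`-optimal. -/
def ZPolicyOpt (z : EReal) (lam : ℝ) : Prop :=
  ∀ x, P.F x z - lam * P.G x z = P.V lam x

/-- The `z⁻`-policy is `P_lam`-optimal. -/
def ZmPolicyOpt (z : EReal) (lam : ℝ) : Prop :=
  ∀ x, P.Fm x z - lam * P.Gm x z = P.V lam x

/-- The project is strongly threshold-indexable with index `ν`. -/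
def StronglyThresholdIndexable (ν : ℝ → ℝ) : Prop :=
  P.Indexable ν ∧
    ∀ lam : ℝ, ∃ z : EReal, P.ZPolicyOpt z lam ∧ P.ZmPolicyOpt z lam

/-- PCL-indexability condition (PCLI1). -/
def PCLI1 : Prop := ∀ (x : ℝ) (z : EReal), 0 < P.g x z

/-- PCL-indexability condition (PCLI2). -/
def PCLI2 : Prop :=
  Monotone P.mStar ∧ Continuous P.mStar ∧ BddBelow (Set.range P.mStar)

/-- PCL-indexability condition (PCLI3). -/
def PCLI3 : Prop :=
  ∀ x : ℝ, ∀ ν : Measure ℝ, IsLSMeasureOfAnti (fun z : ℝ => P.G x z) ν →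
    ∀ z₁ z₂ : ℝ, z₁ < z₂ →
      P.F x z₂ - P.F x z₁ = -∫ z in Set.Ioc z₁ z₂, P.mStar z ∂ν

/-- The project is PCL-indexable. -/
def PCLIndexable : Prop := P.PCLI1 ∧ P.PCLI2 ∧ P.PCLI3

/-- Reward metric with initial distribution `p`. -/
def Fp (p : Measure ℝ) (z : EReal) : ℝ := ∫ x, P.F x z ∂p

/-- Resource metric with initial distribution `p`. -/
def Gp (p : Measure ℝ) (z : EReal) : ℝ := ∫ x, P.G x z ∂p

/-- `z⁻`-policy reward metric with initial distribution `p`. -/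
def Fmp (p : Measure ℝ) (z : EReal) : ℝ := ∫ x, P.Fm x z ∂p

/-- `z⁻`-policy resource metric with initial distribution `p`. -/
def Gmp (p : Measure ℝ) (z : EReal) : ℝ := ∫ x, P.Gm x z ∂p

/-- An admissible initial distribution: a probability measure with `∫ w dp < ∞`. -/
def IsInitDist (p : Measure ℝ) : Prop :=
  IsProbabilityMeasure p ∧ Integrable P.w p

/-- The transition kernel of the `z`-policy (active iff `x > z`). -/
def thrKer (z : EReal) : Kernel ℝ ℝ :=
  haveI : DecidablePred (· ∈ {x : ℝ | z < (x : EReal)}) := Classical.decPred _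
  Kernel.piecewise
    (show MeasurableSet {x : ℝ | z < (x : EReal)} from
      measurable_coe_real_ereal measurableSet_Ioi)
    (P.κ true) (P.κ false)

/-- The transition kernel of the `z⁻`-policy (active iff `x ≥ z`). -/
def thrKerM (z : EReal) : Kernel ℝ ℝ :=
  haveI : DecidablePred (· ∈ {x : ℝ | z ≤ (x : EReal)}) := Classical.decPred _
  Kernel.piecewise
    (show MeasurableSet {x : ℝ | z ≤ (x : EReal)} from
      measurable_coe_real_ereal measurableSet_Ici)
    (P.κ true) (P.κ false)

/-- The (discounted) state occupation measure `μ_p^z` of the `z`-policy. -/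
def occ (z : EReal) (p : Measure ℝ) : Measure ℝ :=
  Measure.sum fun t : ℕ => ENNReal.ofReal (P.β ^ t) • kerIter (P.thrKer z) t p

/-- The (discounted) state occupation measure `μ_p^{z⁻}` of the `z⁻`-policy. -/
def occM (z : EReal) (p : Measure ℝ) : Measure ℝ :=
  Measure.sum fun t : ℕ => ENNReal.ofReal (P.β ^ t) • kerIter (P.thrKerM z) t p

end Bandit

/-- Finite-horizon reward metric `F_k(x,z)` (value iteration). -/
def Bandit.Fk (P : Bandit) : ℕ → ℝ → EReal → ℝ
  | 0, x, z => P.r x (decide (z < (x : EReal)))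
  | (k + 1), x, z =>
      P.r x (decide (z < (x : EReal))) +
        P.β * ∫ y, Bandit.Fk P k y z ∂(P.κ (decide (z < (x : EReal))) x)

/-- Finite-horizon resource metric `G_k(x,z)` (value iteration). -/
def Bandit.Gk (P : Bandit) : ℕ → ℝ → EReal → ℝ
  | 0, x, z => P.c x (decide (z < (x : EReal)))
  | (k + 1), x, z =>
      P.c x (decide (z < (x : EReal))) +
        P.β * ∫ y, Bandit.Gk P k y z ∂(P.κ (decide (z < (x : EReal))) x)

/-- Finite-horizon marginal reward metric `f_k(x,z)`. -/
def Bandit.fk (P : Bandit) : ℕ → ℝ → EReal → ℝ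
  | 0, x, _ => P.r x true - P.r x false
  | (k + 1), x, z =>
      (P.r x true - P.r x false) +
        P.β * ((∫ y, P.Fk k y z ∂(P.κ true x)) - ∫ y, P.Fk k y z ∂(P.κ false x))

/-- Finite-horizon marginal resource metric `g_k(x,z)`. -/
def Bandit.gk (P : Bandit) : ℕ → ℝ → EReal → ℝ
  | 0, x, _ => P.c x true - P.c x false
  | (k + 1), x, z =>
      (P.c x true - P.c x false) +
        P.β * ((∫ y, P.Gk k y z ∂(P.κ true x)) - ∫ y, P.Gk k y z ∂(P.κ false x))

namespace Bandit

variable (P : Bandit)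

/-- Finite-horizon MP metric `m_k(x,z)`. -/
def mk' (k : ℕ) (x : ℝ) (z : EReal) : ℝ := P.fk k x z / P.gk k x z

/-- Finite-horizon MP index `m*_k(x)`. -/
def mkStar (k : ℕ) (x : ℝ) : ℝ := P.mk' k x (x : EReal)

/-- `g̲(x,z) = inf_k g_k(x,z)`. -/
def gbar (x : ℝ) (z : EReal) : ℝ := ⨅ k : ℕ, P.gk k x z

end Bandit

namespace Bandit

/-- A function that is measurable and `w`-bounded is integrable whenever `w` is. -/
lemma integrable_of_abs_le (P : Bandit) {u : ℝ → ℝ} (hu : Measurable u) {C : ℝ}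
    (hC : ∀ x, |u x| ≤ C * P.w x) {μ : Measure ℝ} (hw : Integrable P.w μ) :
    Integrable u μ :=
  (hw.const_mul C).mono' hu.aestronglyMeasurable (.of_forall hC)

/-- A constant that bounds a function relative to `w` is nonnegative. -/
lemma const_nonneg (P : Bandit) {u : ℝ → ℝ} {C : ℝ} (hC : ∀ x, |u x| ≤ C * P.w x) : 0 ≤ C :=
  nonneg_of_mul_nonneg_left ((abs_nonneg _).trans (hC 0)) (zero_lt_one.trans_le (P.hw_one 0))

lemma γ_nonneg (P : Bandit) : 0 ≤ P.γ := P.hβ0.trans P.hβγ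

/-- Comparison principle: a `w`-bounded function dominating its discounted one-step expectation
under some action in every state is nonnegative. -/
lemma nonneg_of_discounted_le (P : Bandit) {u : ℝ → ℝ} (hu : Measurable u) {C : ℝ}
    (hC : ∀ x, |u x| ≤ C * P.w x)
    (hle : ∀ x, ∃ a, P.β * ∫ y, u y ∂(P.κ a x) ≤ u x) (x : ℝ) : 0 ≤ u x := by
  have hC0 := P.const_nonneg hC
  have key : ∀ (k : ℕ) (x : ℝ), -(C * P.γ ^ k * P.w x) ≤ u x := by
    intro k
    induction k with
    | zero => intro x; simpa using (abs_le.1 (hC x)).1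
    | succ k ih =>
      intro x
      obtain ⟨a, ha⟩ := hle x
      refine le_trans ?_ ha
      have h1 : ∫ y, -(C * P.γ ^ k * P.w y) ∂(P.κ a x) ≤ ∫ y, u y ∂(P.κ a x) :=
        integral_mono ((P.hw_int a x).const_mul _).neg
          (P.integrable_of_abs_le hu hC (P.hw_int a x)) ih
      rw [integral_neg, integral_const_mul] at h1
      have h2 := mul_le_mul_of_nonneg_left (P.hw_drift a x)
        (mul_nonneg hC0 (pow_nonneg P.γ_nonneg k))
      have h3 := mul_le_mul_of_nonneg_left h1 P.hβ0
      rw [pow_succ]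
      linarith
  have hlim : Tendsto (fun k : ℕ => -(C * P.γ ^ k * P.w x)) atTop (𝓝 0) := by
    have := ((tendsto_pow_atTop_nhds_zero_of_lt_one P.γ_nonneg P.hγ1).const_mul C).mul_const (P.w x)
    simpa using this.neg
  exact le_of_tendsto' hlim fun k => key k x

/-- `Φ` is the family of threshold-policy performance metrics of the one-stage payoff `ρ`. -/
structure IsMetric (P : Bandit) (ρ : ℝ → Bool → ℝ) (Φ : ℝ → EReal → ℝ) : Prop where
  payoff_le : ∀ x a, |ρ x a| ≤ P.M * P.w x
  meas : ∀ z, Measurable fun x => Φ x z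
  bdd : ∀ z, ∃ C, ∀ x, |Φ x z| ≤ C * P.w x
  eq : ∀ x z, Φ x z = ρ x (decide (z < (x : EReal))) +
    P.β * ∫ y, Φ y z ∂(P.κ (decide (z < (x : EReal))) x)

lemma isMetric_F (P : Bandit) : P.IsMetric P.r P.F :=
  ⟨P.hr_bd, P.hF_meas, P.hF_bdd, P.hF_eq⟩

lemma isMetric_G (P : Bandit) : P.IsMetric P.c P.G := by
  refine ⟨fun x a => ?_, P.hG_meas, P.hG_bdd, P.hG_eq⟩
  have h0 : 0 ≤ P.c x a := by
    cases a
    · exact P.hc0 x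
    · exact (P.hc0 x).trans (P.hc01 x).le
  rw [abs_of_nonneg h0]
  exact P.hc_bd x a

namespace IsMetric

variable {P : Bandit} {ρ : ℝ → Bool → ℝ} {Φ : ℝ → EReal → ℝ}

lemma integrable (h : P.IsMetric ρ Φ) (z : EReal) {μ : Measure ℝ} (hw : Integrable P.w μ) :
    Integrable (fun x => Φ x z) μ :=
  let ⟨_, hC⟩ := h.bdd z
  P.integrable_of_abs_le (h.meas z) hC hw

/-- The performance metrics are `w`-bounded uniformly in the threshold. -/
lemma abs_le_weight (h : P.IsMetric ρ Φ) (x : ℝ) (z : EReal) :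
    |Φ x z| ≤ P.M / (1 - P.γ) * P.w x := by
  have hγ : 0 < 1 - P.γ := sub_pos.2 P.hγ1
  set K := P.M / (1 - P.γ) with hK
  have hK0 : 0 ≤ K := div_nonneg P.hM.le hγ.le
  have hKM : K * (1 - P.γ) = P.M := div_mul_cancel₀ _ hγ.ne'
  have key : ∀ s : ℝ, |s| = 1 → 0 ≤ K * P.w x + s * Φ x z := by
    intro s hs
    obtain ⟨C, hC⟩ := h.bdd z
    refine P.nonneg_of_discounted_le (u := fun x => K * P.w x + s * Φ x z) (C := K + C)
      ((P.hw_meas.const_mul K).add ((h.meas z).const_mul s)) (fun x => ?_) (fun x => ?_) x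
    · calc |K * P.w x + s * Φ x z| ≤ |K * P.w x| + |s * Φ x z| := abs_add_le _ _
        _ ≤ (K + C) * P.w x := by
          rw [abs_mul, abs_mul, hs, abs_of_nonneg hK0,
            abs_of_nonneg (zero_le_one.trans (P.hw_one x))]
          linarith [hC x]
    · refine ⟨decide (z < (x : EReal)), ?_⟩
      generalize ha : decide (z < (x : EReal)) = a
      have hi := P.hw_int a x
      have heq := h.eq x z
      rw [ha] at heq
      rw [integral_add (hi.const_mul K) ((h.integrable z hi).const_mul s), integral_const_mul,
        integral_const_mul, heq]
      have h1 := mul_le_mul_of_nonneg_left (P.hw_drift a x) hK0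
      have h2 : -(P.M * P.w x) ≤ s * ρ x a :=
        (abs_le.1 (by rw [abs_mul, hs, one_mul]; exact h.payoff_le x a)).1
      have h3 : K * P.w x - K * (P.γ * P.w x) = P.M * P.w x := by rw [← hKM]; ring
      linarith
  have h1 := key 1 (by simp)
  have h2 := key (-1) (by simp)
  exact abs_le.2 ⟨by linarith, by linarith⟩

/-- Continuity of the performance metrics along thresholds whose actions stabilize pointwise. -/
lemma tendsto (h : P.IsMetric ρ Φ) {ζ : ℕ → EReal} {z : EReal}
    (hζ : ∀ x : ℝ, ∀ᶠ n in atTop, (ζ n < (x : EReal) ↔ z < (x : EReal))) (x : ℝ) :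
    Tendsto (fun n => Φ x (ζ n)) atTop (𝓝 (Φ x z)) := by
  set K := P.M / (1 - P.γ) with hK
  have hK0 : 0 ≤ K := div_nonneg P.hM.le (sub_pos.2 P.hγ1).le
  let E : ℕ → ℝ → ENNReal := fun n x => ENNReal.ofReal |Φ x (ζ n) - Φ x z|
  have hE_meas : ∀ n, Measurable (E n) := fun n =>
    (continuous_abs.measurable.comp ((h.meas _).sub (h.meas _))).ennreal_ofReal
  have hE_le : ∀ n x, E n x ≤ ENNReal.ofReal (2 * K * P.w x) := fun n x =>
    ENNReal.ofReal_le_ofReal <| (abs_sub _ _).trans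
      (by linarith [h.abs_le_weight x (ζ n), h.abs_le_weight x z])
  have hlint : ∀ (k : ℕ) (a : Bool) (x : ℝ),
      ∫⁻ y, ENNReal.ofReal (2 * K * P.γ ^ k * P.w y) ∂(P.κ a x) =
        ENNReal.ofReal (2 * K * P.γ ^ k * ∫ y, P.w y ∂(P.κ a x)) := by
    intro k a x
    rw [← integral_const_mul, ofReal_integral_eq_lintegral_ofReal ((P.hw_int a x).const_mul _)]
    exact .of_forall fun y => mul_nonneg (mul_nonneg (by positivity) (pow_nonneg P.γ_nonneg k))
      (zero_le_one.trans (P.hw_one y))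
  have hstep : ∀ x, ∀ᶠ n in atTop, E n x ≤
      ENNReal.ofReal P.β * ∫⁻ y, E n y ∂(P.κ (decide (z < (x : EReal))) x) := by
    intro x
    filter_upwards [hζ x] with n hn
    have e1 := h.eq x (ζ n)
    have e2 := h.eq x z
    rw [decide_eq_decide.2 hn] at e1
    generalize decide (z < (x : EReal)) = a at e1 e2 ⊢
    have hi1 := h.integrable (ζ n) (P.hw_int a x)
    have hi2 := h.integrable z (P.hw_int a x)
    have e3 : Φ x (ζ n) - Φ x z = P.β * ∫ y, (Φ y (ζ n) - Φ y z) ∂(P.κ a x) := by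
      rw [integral_sub hi1 hi2, e1, e2]; ring
    have e4 : ∫⁻ y, E n y ∂(P.κ a x) =
        ENNReal.ofReal (∫ y, |Φ y (ζ n) - Φ y z| ∂(P.κ a x)) :=
      (ofReal_integral_eq_lintegral_ofReal (hi1.sub hi2).abs
        (.of_forall fun y => abs_nonneg _)).symm
    rw [e4, ← ENNReal.ofReal_mul P.hβ0]
    refine ENNReal.ofReal_le_ofReal ?_
    rw [e3, abs_mul, abs_of_nonneg P.hβ0]
    exact mul_le_mul_of_nonneg_left abs_integral_le_integral_abs P.hβ0
  have key : ∀ (k : ℕ) (x : ℝ),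
      limsup (fun n => E n x) atTop ≤ ENNReal.ofReal (2 * K * P.γ ^ k * P.w x) := by
    intro k
    induction k with
    | zero =>
      intro x
      refine limsup_le_of_le (by isBoundedDefault) (.of_forall fun n => ?_)
      simpa using hE_le n x
    | succ k ih =>
      intro x
      have hst := hstep x
      generalize decide (z < (x : EReal)) = a at hst
      calc limsup (fun n => E n x) atTop
          ≤ limsup (fun n => ENNReal.ofReal P.β * ∫⁻ y, E n y ∂(P.κ a x)) atTop :=
            limsup_le_limsup hst
        _ = ENNReal.ofReal P.β * limsup (fun n => ∫⁻ y, E n y ∂(P.κ a x)) atTop :=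
            ENNReal.limsup_const_mul_of_ne_top ENNReal.ofReal_ne_top
        _ ≤ ENNReal.ofReal P.β * ∫⁻ y, limsup (fun n => E n y) atTop ∂(P.κ a x) := by
            gcongr
            refine limsup_lintegral_le _ hE_meas (fun n => .of_forall (hE_le n)) ?_
            have := hlint 0 a x
            simp only [pow_zero, mul_one] at this
            rw [this]
            exact ENNReal.ofReal_ne_top
        _ ≤ ENNReal.ofReal P.β *
            ∫⁻ y, ENNReal.ofReal (2 * K * P.γ ^ k * P.w y) ∂(P.κ a x) := by
            gcongr with y
            exact ih y
        _ ≤ ENNReal.ofReal (2 * K * P.γ ^ (k + 1) * P.w x) := by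
            rw [hlint, ← ENNReal.ofReal_mul P.hβ0]
            refine ENNReal.ofReal_le_ofReal ?_
            have := mul_le_mul_of_nonneg_left (P.hw_drift a x)
              (mul_nonneg (mul_nonneg zero_le_two hK0) (pow_nonneg P.γ_nonneg k))
            rw [pow_succ]
            linarith
  have hzero : limsup (fun n => E n x) atTop ≤ 0 := by
    have hlim : Tendsto (fun k : ℕ => ENNReal.ofReal (2 * K * P.γ ^ k * P.w x)) atTop (𝓝 0) := by
      have := ((tendsto_pow_atTop_nhds_zero_of_lt_one P.γ_nonneg P.hγ1).const_mul
        (2 * K)).mul_const (P.w x)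
      rw [mul_zero, zero_mul] at this
      simpa using ENNReal.tendsto_ofReal this
    exact ge_of_tendsto' hlim fun k => key k x
  have hE0 : Tendsto (fun n => E n x) atTop (𝓝 0) :=
    tendsto_of_le_liminf_of_limsup_le zero_le hzero
  rw [tendsto_iff_norm_sub_tendsto_zero]
  have := (ENNReal.tendsto_toReal ENNReal.zero_ne_top).comp hE0
  refine this.congr fun n => ?_
  simp [E, Real.norm_eq_abs]

/-- The metric of each state is right-continuous in the threshold. -/
lemma continuousWithinAt_Ici (h : P.IsMetric ρ Φ) (x z : ℝ) :
    ContinuousWithinAt (fun t : ℝ => Φ x t) (Ici z) z := by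
  refine tendsto_of_seq_tendsto fun ζ hζ => h.tendsto (ζ := fun k => (ζ k : EReal)) (fun y => ?_) x
  obtain ⟨h1, h2⟩ := tendsto_nhdsWithin_iff.1 hζ
  simp only [EReal.coe_lt_coe_iff]
  rcases lt_or_ge z y with hy | hy
  · filter_upwards [h1.eventually_lt_const hy] with n hn
    exact iff_of_true hn hy
  · filter_upwards [h2] with n hn
    exact iff_of_false (not_lt.2 (hy.trans hn)) (not_lt.2 hy)

lemma tendsto_integral (h : P.IsMetric ρ Φ) {ζ : ℕ → EReal} {z : EReal}
    (hζ : ∀ x : ℝ, ∀ᶠ n in atTop, (ζ n < (x : EReal) ↔ z < (x : EReal)))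
    {μ : Measure ℝ} (hw : Integrable P.w μ) :
    Tendsto (fun n => ∫ x, Φ x (ζ n) ∂μ) atTop (𝓝 (∫ x, Φ x z ∂μ)) :=
  tendsto_integral_of_dominated_convergence _ (fun _ => (h.meas _).aestronglyMeasurable)
    (hw.const_mul _) (fun _ => .of_forall fun x => h.abs_le_weight x _)
    (.of_forall (h.tendsto hζ))

lemma abs_integral_le (h : P.IsMetric ρ Φ) {μ : Measure ℝ} (hw : Integrable P.w μ) (z : EReal) :
    |∫ x, Φ x z ∂μ| ≤ P.M / (1 - P.γ) * ∫ x, P.w x ∂μ := by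
  rw [← integral_const_mul]
  exact norm_integral_le_of_norm_le (f := fun x => Φ x z) (hw.const_mul _)
    (.of_forall fun x => h.abs_le_weight x z)

end IsMetric

/-- Under (PCLI1) the resource metric is nonincreasing in the threshold. -/
lemma antitone_G (P : Bandit) (h1 : P.PCLI1) (x : ℝ) : Antitone (P.G x) := by
  intro z₁ z₂ hz
  have hG := P.isMetric_G
  rw [← sub_nonneg]
  refine P.nonneg_of_discounted_le (u := fun x => P.G x z₁ - P.G x z₂)
    (C := 2 * (P.M / (1 - P.γ))) ((hG.meas _).sub (hG.meas _))
    (fun x => (abs_sub _ _).trans (by linarith [hG.abs_le_weight x z₁, hG.abs_le_weight x z₂]))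
    (fun x => ⟨decide (z₁ < (x : EReal)), ?_⟩) x
  have e1 := hG.eq x z₁
  have e2 := hG.eq x z₂
  by_cases hx : z₁ < (x : EReal) ↔ z₂ < (x : EReal)
  · rw [← decide_eq_decide.2 hx] at e2
    rw [integral_sub (hG.integrable _ (P.hw_int _ _)) (hG.integrable _ (P.hw_int _ _)), e1, e2]
    linarith
  · have hx1 : z₁ < (x : EReal) := by
      by_contra hn
      exact hx (iff_of_false hn fun h' => hn (hz.trans_lt h'))
    have hx2 : ¬ z₂ < (x : EReal) := fun h' => hx (iff_of_true hx1 h')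
    have hg := h1 x z₂
    rw [Bandit.g] at hg
    simp only [hx1, hx2, decide_true, decide_false] at e1 e2 ⊢
    rw [integral_sub (hG.integrable _ (P.hw_int _ _)) (hG.integrable _ (P.hw_int _ _)), e1, e2]
    linarith

end Bandit

/-- A function whose increments are dominated by the product of the increments of a continuous
function and of a monotone one is constant. -/
lemma eq_of_abs_sub_le_mul {Φ m K : ℝ → ℝ} {a b : ℝ} (hab : a ≤ b) (hm : Continuous m)
    (hK : Monotone K)
    (h : ∀ s t, a ≤ s → s ≤ t → t ≤ b → |Φ t - Φ s| ≤ (m t - m s) * (K t - K s)) :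
    Φ a = Φ b := by
  have key : ∀ ε > 0, |Φ b - Φ a| ≤ ε * (K b - K a) := by
    intro ε hε
    obtain ⟨δ, hδ, hmδ⟩ := Metric.uniformContinuousOn_iff.1
      (isCompact_Icc.uniformContinuousOn_of_continuous (hm.continuousOn (s := Icc a b))) ε hε
    have hind : ∀ (n : ℕ) (t : ℝ), a ≤ t → t ≤ b → t - a ≤ n * (δ / 2) →
        |Φ t - Φ a| ≤ ε * (K t - K a) := by
      intro n
      induction n with
      | zero =>
        intro t h1 _ h3
        obtain rfl : t = a := le_antisymm (by simpa using h3) h1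
        simp
      | succ n ih =>
        intro t h1 h2 h3
        have hs1 : a ≤ max a (t - δ / 2) := le_max_left _ _
        have hst : max a (t - δ / 2) ≤ t := max_le h1 (by linarith)
        have hs2 : t - δ / 2 ≤ max a (t - δ / 2) := le_max_right _ _
        have hs3 : max a (t - δ / 2) - a ≤ n * (δ / 2) := by
          push_cast at h3
          rw [← max_sub_sub_right, sub_self]
          exact max_le (by positivity) (by linarith)
        generalize max a (t - δ / 2) = s at hs1 hst hs2 hs3
        have e1 := ih s hs1 (hst.trans h2) hs3
        have e2 : m t - m s ≤ ε := by
          refine (le_abs_self _).trans (hmδ t ⟨h1, h2⟩ s ⟨hs1, hst.trans h2⟩ ?_).le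
          rw [Real.dist_eq, abs_of_nonneg (sub_nonneg.2 hst)]
          linarith
        have e3 := (h s t hs1 hst h2).trans
          (mul_le_mul_of_nonneg_right e2 (sub_nonneg.2 (hK hst)))
        have e4 := abs_sub_le (Φ t) (Φ s) (Φ a)
        linarith
    obtain ⟨n, hn⟩ := exists_nat_ge ((b - a) / (δ / 2))
    exact hind n b hab le_rfl ((div_le_iff₀ (by positivity)).1 hn)
  have hk : 0 < K b - K a + 1 := by linarith [hK hab]
  by_contra hne
  have hd : 0 < |Φ b - Φ a| := abs_pos.2 (sub_ne_zero.2 (Ne.symm hne))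
  have h1 := key _ (div_pos hd hk)
  rw [div_mul_eq_mul_div, le_div_iff₀ hk] at h1
  linarith

namespace IsLSMeasureOfAnti

variable {h : ℝ → ℝ} {ν : Measure ℝ}

lemma measure_Ioc_ne_top (hν : IsLSMeasureOfAnti h ν) {a b : ℝ} (hab : a ≤ b) :
    ν (Ioc a b) ≠ ⊤ := by
  rw [hν a b hab]
  exact ENNReal.ofReal_ne_top

lemma real_Ioc (hν : IsLSMeasureOfAnti h ν) (hh : Antitone h) {a b : ℝ} (hab : a ≤ b) :
    ν.real (Ioc a b) = h a - h b := by
  rw [Measure.real, hν a b hab, ENNReal.toReal_ofReal (sub_nonneg.2 (hh hab))]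

lemma integrableOn_Ioc (hν : IsLSMeasureOfAnti h ν) {m : ℝ → ℝ} (hm : Monotone m) {a b : ℝ}
    (hab : a ≤ b) : IntegrableOn m (Ioc a b) ν := by
  refine Measure.integrableOn_of_bounded (M := max |m a| |m b|) (hν.measure_Ioc_ne_top hab)
    hm.measurable.aestronglyMeasurable ?_
  filter_upwards [ae_restrict_mem measurableSet_Ioc] with x hx
  exact abs_le_max_abs_abs (hm hx.1.le) (hm hx.2)

lemma mul_le_setIntegral (hν : IsLSMeasureOfAnti h ν) (hh : Antitone h) {m : ℝ → ℝ}
    (hm : Monotone m) {a b : ℝ} (hab : a ≤ b) :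
    m a * (h a - h b) ≤ ∫ x in Ioc a b, m x ∂ν := by
  have := setIntegral_mono_on (integrableOn_const (hν.measure_Ioc_ne_top hab))
    (hν.integrableOn_Ioc hm hab) measurableSet_Ioc fun x hx => hm hx.1.le
  rwa [setIntegral_const, hν.real_Ioc hh hab, smul_eq_mul, mul_comm] at this

lemma setIntegral_le_mul (hν : IsLSMeasureOfAnti h ν) (hh : Antitone h) {m : ℝ → ℝ}
    (hm : Monotone m) {a b : ℝ} (hab : a ≤ b) :
    ∫ x in Ioc a b, m x ∂ν ≤ m b * (h a - h b) := by
  have := setIntegral_mono_on (hν.integrableOn_Ioc hm hab)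
    (integrableOn_const (hν.measure_Ioc_ne_top hab)) measurableSet_Ioc fun x hx => hm hx.2
  rwa [setIntegral_const, hν.real_Ioc hh hab, smul_eq_mul, mul_comm] at this

end IsLSMeasureOfAnti

/-- Every extended real is approached by real thresholds, from the available side, whose induced
actions stabilize pointwise. -/
lemma exists_seq_threshold (z : EReal) : ∃ a : ℕ → ℝ,
    (z ≠ ⊤ → ∀ n, z ≤ a n) ∧ (z ≠ ⊥ → ∀ n, (a n : EReal) ≤ z) ∧
    ∀ x : ℝ, ∀ᶠ n in atTop, ((a n : EReal) < x ↔ z < x) := by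
  induction z with
  | bot =>
    refine ⟨fun n => -n, fun _ _ => bot_le, fun h => absurd rfl h, fun x => ?_⟩
    filter_upwards [(tendsto_neg_atTop_atBot.comp
      tendsto_natCast_atTop_atTop).eventually_lt_atBot x] with n hn
    exact iff_of_true (EReal.coe_lt_coe_iff.2 hn) (EReal.bot_lt_coe x)
  | coe z =>
    exact ⟨fun _ => z, fun _ _ => le_rfl, fun _ _ => le_rfl, fun _ => .of_forall fun _ => .rfl⟩
  | top =>
    refine ⟨fun n => n, fun h => absurd rfl h, fun _ _ => le_top, fun x => ?_⟩
    filter_upwards [tendsto_natCast_atTop_atTop.eventually_ge_atTop x] with n hn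
    exact iff_of_false (not_lt.2 (EReal.coe_le_coe_iff.2 hn)) not_top_lt

namespace Bandit

/-- The resource metric of a state has a Lebesgue–Stieltjes measure under (PCLI1). -/
lemma exists_isLSMeasureOfAnti_G (P : Bandit) (h1 : P.PCLI1) (x : ℝ) :
    ∃ ν : Measure ℝ, IsLSMeasureOfAnti (fun z : ℝ => P.G x z) ν := by
  let S : StieltjesFunction ℝ :=
    { toFun := fun z => -P.G x z
      mono' := fun s t hst => neg_le_neg (P.antitone_G h1 x (EReal.coe_le_coe_iff.2 hst))
      right_continuous' := fun z => (P.isMetric_G.continuousWithinAt_Ici x z).neg }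
  refine ⟨S.measure, fun s t _ => ?_⟩
  rw [S.measure_Ioc]
  congr 1
  change -P.G x t - -P.G x s = _
  ring

lemma antitone_G_coe (P : Bandit) (h1 : P.PCLI1) (x : ℝ) : Antitone fun z : ℝ => P.G x z :=
  (P.antitone_G h1 x).comp_monotone EReal.coe_strictMono.monotone

lemma antitone_Gp (P : Bandit) (h1 : P.PCLI1) {p : Measure ℝ} (hp : Integrable P.w p) :
    Antitone fun z : ℝ => P.Gp p z := fun _ _ hst =>
  integral_mono (P.isMetric_G.integrable _ hp) (P.isMetric_G.integrable _ hp)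
    fun x => P.antitone_G_coe h1 x hst

/-- Two-sided bound of the increments of the reward metric by those of the resource metric. -/
lemma sub_F_mem_Icc (P : Bandit) (h : P.PCLIndexable) (x : ℝ) {s t : ℝ} (hst : s ≤ t) :
    P.F x s - P.F x t ∈
      Icc (P.mStar s * (P.G x s - P.G x t)) (P.mStar t * (P.G x s - P.G x t)) := by
  obtain ⟨h1, h2, h3⟩ := h
  rcases hst.eq_or_lt with rfl | hlt
  · simp
  obtain ⟨ν, hν⟩ := P.exists_isLSMeasureOfAnti_G h1 x
  have e := h3 x ν hν s t hlt
  have hA := P.antitone_G_coe h1 x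
  have l := hν.mul_le_setIntegral hA h2.1 hst
  have u := hν.setIntegral_le_mul hA h2.1 hst
  constructor <;> linarith

lemma sub_Fp_mem_Icc (P : Bandit) (h : P.PCLIndexable) {p : Measure ℝ} (hp : Integrable P.w p)
    {s t : ℝ} (hst : s ≤ t) :
    P.Fp p s - P.Fp p t ∈
      Icc (P.mStar s * (P.Gp p s - P.Gp p t)) (P.mStar t * (P.Gp p s - P.Gp p t)) := by
  have iF : ∀ z, Integrable (fun x => P.F x z) p := fun z => P.isMetric_F.integrable z hp
  have iG : ∀ z, Integrable (fun x => P.G x z) p := fun z => P.isMetric_G.integrable z hp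
  simp only [Fp, Gp]
  rw [← integral_sub (iF _) (iF _), ← integral_sub (iG _) (iG _), ← integral_const_mul,
    ← integral_const_mul]
  exact ⟨integral_mono (((iG _).sub (iG _)).const_mul _) ((iF _).sub (iF _))
      fun x => (P.sub_F_mem_Icc h x hst).1,
    integral_mono ((iF _).sub (iF _)) (((iG _).sub (iG _)).const_mul _)
      fun x => (P.sub_F_mem_Icc h x hst).2⟩

/-- Condition (PCLI3) for an initial distribution and a bounded interval. -/
lemma sub_Fp_eq_setIntegral (P : Bandit) (h : P.PCLIndexable) {p : Measure ℝ}
    (hp : Integrable P.w p) {ν : Measure ℝ} (hν : IsLSMeasureOfAnti (fun z : ℝ => P.Gp p z) ν)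
    {a b : ℝ} (hab : a ≤ b) :
    P.Fp p a - P.Fp p b = ∫ z in Ioc a b, P.mStar z ∂ν := by
  have hA := P.antitone_Gp h.1 hp
  have hm := h.2.1.1
  have := eq_of_abs_sub_le_mul (Φ := fun t => P.Fp p t + ∫ z in Ioc a t, P.mStar z ∂ν)
    (K := fun z => -P.Gp p z) hab h.2.1.2.1 hA.neg fun s t has hst _ => by
      have e : ∫ z in Ioc a t, P.mStar z ∂ν =
          (∫ z in Ioc a s, P.mStar z ∂ν) + ∫ z in Ioc s t, P.mStar z ∂ν := by
        rw [← Ioc_union_Ioc_eq_Ioc has hst]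
        exact setIntegral_union (Ioc_disjoint_Ioc_of_le le_rfl) measurableSet_Ioc
          (hν.integrableOn_Ioc hm has) (hν.integrableOn_Ioc hm hst)
      obtain ⟨l, u⟩ := P.sub_Fp_mem_Icc h hp hst
      have l' := hν.mul_le_setIntegral hA hm hst
      have u' := hν.setIntegral_le_mul hA hm hst
      rw [e]
      exact abs_le.2 ⟨by linarith, by linarith⟩
  simp only [Ioc_self, Measure.restrict_empty, integral_zero_measure, add_zero] at this
  linarith

end Bandit

/-- Under PCL-indexability, condition (PCLI3) extends to the initial
distribution `p` and to infinite intervals: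
`F(p,z₂) − F(p,z₁) = ∫_{(z₁,z₂]} m*(z) G(p,dz)` for `−∞ ≤ z₁ < z₂ ≤ ∞`. -/
theorem pcli3_extended (P : Bandit) (h : P.PCLIndexable)
    (p : Measure ℝ) (hp : P.IsInitDist p)
    (ν : Measure ℝ) (hν : IsLSMeasureOfAnti (fun z : ℝ => P.Gp p z) ν)
    (z₁ z₂ : EReal) (hlt : z₁ < z₂) :
    P.Fp p z₂ - P.Fp p z₁ = -∫ z in iocR z₁ z₂, P.mStar z ∂ν := by
  obtain ⟨-, hw⟩ := hp
  obtain ⟨hm, -, B, hB⟩ := h.2.1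
  obtain ⟨a, ha, -, haz⟩ := exists_seq_threshold z₁
  obtain ⟨b, -, hb, hbz⟩ := exists_seq_threshold z₂
  have hab : ∀ᶠ n in atTop, a n ≤ b n := by
    obtain ⟨x, hx1, hx2⟩ := EReal.lt_iff_exists_real_btwn.1 hlt
    filter_upwards [haz x, hbz x] with n h1 h2
    exact EReal.coe_le_coe_iff.1
      ((h1.2 hx1).le.trans (not_lt.1 fun hn => (h2.1 hn).not_gt hx2))
  have hsub : ∀ n, Ioc (a n) (b n) ⊆ iocR z₁ z₂ := fun n x hx =>
    ⟨(ha hlt.ne_top n).trans_lt (EReal.coe_lt_coe_iff.2 hx.1),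
      (EReal.coe_le_coe_iff.2 hx.2).trans (hb hlt.ne_bot n)⟩
  have hmeas : MeasurableSet (iocR z₁ z₂) :=
    measurable_coe_real_ereal (measurableSet_Ioc : MeasurableSet (Ioc z₁ z₂))
  have hcover : AECover (ν.restrict (iocR z₁ z₂)) atTop fun n => Ioc (a n) (b n) := by
    refine ⟨?_, fun _ => measurableSet_Ioc⟩
    filter_upwards [ae_restrict_mem hmeas] with x hx
    filter_upwards [haz x, hbz x] with n h1 h2
    exact ⟨EReal.coe_lt_coe_iff.1 (h1.2 hx.1),
      EReal.coe_le_coe_iff.1 (not_lt.1 fun hn => (h2.1 hn).not_ge hx.2)⟩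
  have hrestrict : ∀ n, (ν.restrict (iocR z₁ z₂)).restrict (Ioc (a n) (b n)) =
      ν.restrict (Ioc (a n) (b n)) := fun n => Measure.restrict_restrict_of_subset (hsub n)
  have hIoc : ∀ n, IntegrableOn P.mStar (Ioc (a n) (b n)) ν := by
    intro n
    rcases le_total (a n) (b n) with hn | hn
    · exact hν.integrableOn_Ioc hm hn
    · simp [Ioc_eq_empty_of_le hn]
  have hint : Integrable P.mStar (ν.restrict (iocR z₁ z₂)) := by
    set C := P.M / (1 - P.γ) * ∫ x, P.w x ∂p
    refine hcover.integrable_of_integral_norm_bounded (2 * C + 2 * |B| * (2 * C))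
      (fun n => by rw [IntegrableOn, hrestrict]; exact hIoc n) ?_
    filter_upwards [hab] with n hn
    rw [hrestrict]
    have hconst : IntegrableOn (fun _ => 2 * |B|) (Ioc (a n) (b n)) ν :=
      integrableOn_const (hν.measure_Ioc_ne_top hn)
    have habs : ∀ x, |P.mStar x| ≤ P.mStar x + 2 * |B| := fun x => by
      have h1 : B ≤ P.mStar x := hB (mem_range_self x)
      have h2 := neg_abs_le B
      have h3 := abs_nonneg B
      exact abs_le.2 ⟨by linarith, by linarith⟩
    calc ∫ x in Ioc (a n) (b n), ‖P.mStar x‖ ∂ν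
        ≤ ∫ x in Ioc (a n) (b n), (P.mStar x + 2 * |B|) ∂ν :=
          integral_mono (hIoc n).norm ((hIoc n).add hconst) habs
      _ = (P.Fp p (a n) - P.Fp p (b n)) + 2 * |B| * (P.Gp p (a n) - P.Gp p (b n)) := by
          rw [integral_add (hIoc n) hconst, setIntegral_const,
            hν.real_Ioc (P.antitone_Gp h.1 hw) hn, ← P.sub_Fp_eq_setIntegral h hw hν hn,
            smul_eq_mul, mul_comm (2 * |B|)]
      _ ≤ 2 * C + 2 * |B| * (2 * C) := by
          have hF : ∀ z, |P.Fp p z| ≤ C := P.isMetric_F.abs_integral_le hw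
          have hG : ∀ z, |P.Gp p z| ≤ C := P.isMetric_G.abs_integral_le hw
          have f1 := abs_le.1 (hF (a n))
          have f2 := abs_le.1 (hF (b n))
          have g1 := abs_le.1 (hG (a n))
          have g2 := abs_le.1 (hG (b n))
          gcongr <;> linarith
  have hlim := hcover.integral_tendsto_of_countably_generated hint
  have hlim' : Tendsto (fun n => P.Fp p (a n) - P.Fp p (b n)) atTop
      (𝓝 (P.Fp p z₁ - P.Fp p z₂)) :=
    (P.isMetric_F.tendsto_integral haz hw).sub (P.isMetric_F.tendsto_integral hbz hw)
  have := tendsto_nhds_unique_of_eventuallyEq hlim' hlim <| by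
    filter_upwards [hab] with n hn
    rw [hrestrict, P.sub_Fp_eq_setIntegral h hw hν hn]
  linarith
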